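/- Correctness of the reduction from DLog to General-Claw: Given a DLog instance (s, f, id, g, t), define g₀, g₁ : {0,1}^n → {0,1}^n by g₀(u) = bits_n(I(val u)) if val u < s and g₀(u) = u otherwise, and g₁(u) = f(bits_n(t), bits_n(I(val u))) if val u < s and g₁(u) = u otherwise. If any of the following holds: (1) there exist u, v with val u < s, val v < s and g₀(u) = g₁(v); (2) there exist u ≠ v with g₀(u) = g₀(v); (3) there exist u ≠ v with g₁(u) = g₁(v); (4) there exists u with val u < s and val(g₀(u)) ≥ s; (5) there exists u with val u < s and val(g₁(u)) ≥ s — then DLogSol holds, where DLogSol denotes: (∃ x < s, I(x) = t) ∨ (∃ x, y < s, f_G(x,y) ≥ s) ∨ (∃ distinct x, y < s, I(x) = I(y)) ∨ (∃ distinct x, y < s, f_G(t, I(x)) = f_G(t, I(y))) ∨ (∃ x, y < s, I(x) = f_G(t, I(y)) ∧ I((x − y) mod s) ≠ t), and (x − y) mod s means ((x + s) − y) mod s. -/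

import Mathlib

/-- The number whose binary expansion (most significant bit first) is `u`. -/
def valS {n : ℕ} (u : Fin n → Bool) : ℕ :=
  (List.ofFn u).foldl (fun a b => 2*a + (if b then 1 else 0)) 0

/-- The length-`n` binary expansion (most significant bit first) of `m`. -/
def bitsS (n : ℕ) (m : ℕ) : Fin n → Bool := fun i => m.testBit (n - 1 - (i : ℕ))

/-- Square-and-multiply over the binary digits of `x` (most significant bit first,
with the single digit 0 for `x = 0`), starting from `e`. -/
def sqmul {α : Type*} (sq : α → α) (mul : α → α) (e : α) (x : ℕ) : α :=
  (if x = 0 then [false] else x.bits.reverse).foldl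
    (fun r b => if b then mul (sq r) else sq r) e

/-- The binary operator on indices induced by the circuit `f`. -/
def fG (n : ℕ) (f : (Fin n → Bool) → (Fin n → Bool) → Fin n → Bool) (x y : ℕ) : ℕ :=
  valS (f (bitsS n x) (bitsS n y))

/-- The indexing function of a DLog/Index instance, computed by square-and-multiply
with identity index `idx` and generator index `g`. -/
def IdxG (n : ℕ) (f : (Fin n → Bool) → (Fin n → Bool) → Fin n → Bool)
    (idx g : ℕ) (x : ℕ) : ℕ :=
  valS (sqmul (fun r => f r r) (fun r => f (bitsS n g) r) (bitsS n idx) x)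

/-- A solution of the DLog instance `(s, f, idx, g, t)`. -/
def DLogSol (s n : ℕ) (f : (Fin n → Bool) → (Fin n → Bool) → Fin n → Bool)
    (idx g t : ℕ) : Prop :=
  (∃ x < s, IdxG n f idx g x = t) ∨
  (∃ x < s, ∃ y < s, s ≤ fG n f x y) ∨
  (∃ x < s, ∃ y < s, x ≠ y ∧ IdxG n f idx g x = IdxG n f idx g y) ∨
  (∃ x < s, ∃ y < s, x ≠ y ∧
    fG n f t (IdxG n f idx g x) = fG n f t (IdxG n f idx g y)) ∨
  (∃ x < s, ∃ y < s, IdxG n f idx g x = fG n f t (IdxG n f idx g y) ∧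
    IdxG n f idx g ((x + s - y) % s) ≠ t)

/-- The first function of the General-Claw instance built from a DLog instance. -/
def claw0 (s n : ℕ) (f : (Fin n → Bool) → (Fin n → Bool) → Fin n → Bool)
    (idx g : ℕ) (u : Fin n → Bool) : Fin n → Bool :=
  if valS u < s then bitsS n (IdxG n f idx g (valS u)) else u

/-- The second function of the General-Claw instance built from a DLog instance. -/
def claw1 (s n : ℕ) (f : (Fin n → Bool) → (Fin n → Bool) → Fin n → Bool)
    (idx g t : ℕ) (u : Fin n → Bool) : Fin n → Bool :=
  if valS u < s then f (bitsS n t) (bitsS n (IdxG n f idx g (valS u))) else u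

theorem valS_succ {n : ℕ} (u : Fin (n + 1) → Bool) :
    valS u = 2 * valS (fun i : Fin n => u i.castSucc) + (if u (Fin.last n) then 1 else 0) := by
  simp only [valS, List.ofFn_succ_last, List.foldl_append, List.foldl_cons, List.foldl_nil]

theorem valS_lt {n : ℕ} (u : Fin n → Bool) : valS u < 2 ^ n := by
  induction n with
  | zero => simp [valS]
  | succ n ih =>
    have h := ih (fun i => u i.castSucc)
    rw [valS_succ, pow_succ]
    split <;> omega

theorem valS_injective (n : ℕ) : Function.Injective (valS : (Fin n → Bool) → ℕ) := by
  induction n with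
  | zero => exact fun u v _ => Subsingleton.elim u v
  | succ n ih =>
    intro u v h
    rw [valS_succ, valS_succ] at h
    have hinit : valS (fun i : Fin n => u i.castSucc) = valS (fun i : Fin n => v i.castSucc) := by
      split at h <;> split at h <;> omega
    have hlast : u (Fin.last n) = v (Fin.last n) := by
      rw [hinit] at h
      cases hu : u (Fin.last n) <;> cases hv : v (Fin.last n) <;> simp_all
    funext i
    induction i using Fin.lastCases with
    | last => exact hlast
    | cast i => exact congrFun (ih hinit) i

theorem valS_bitsS {n m : ℕ} (hm : m < 2 ^ n) : valS (bitsS n m) = m := by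
  induction n generalizing m with
  | zero => simp_all [valS]
  | succ n ih =>
    have hinit : (fun i : Fin n => bitsS (n + 1) m i.castSucc) = bitsS n (m / 2) := by
      funext i
      have hi := i.isLt
      simp only [bitsS, Fin.val_castSucc, Nat.testBit_div_two]
      congr 1
      omega
    have hlast : bitsS (n + 1) m (Fin.last n) = decide (m % 2 = 1) := by
      simp [bitsS, Nat.testBit_zero]
    rw [valS_succ, hinit, hlast, ih (by rw [pow_succ] at hm; omega)]
    simp only [decide_eq_true_eq]
    split <;> omega

theorem bitsS_valS {n : ℕ} (u : Fin n → Bool) : bitsS n (valS u) = u :=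
  valS_injective n (valS_bitsS (valS_lt u))

/-- Square-and-multiply preserves every predicate preserved by squaring and multiplying. -/
theorem sqmul_induction {α : Type*} {sq mul : α → α} {e : α} (p : α → Prop) (he : p e)
    (hsq : ∀ r, p r → p (sq r)) (hmul : ∀ r, p r → p (mul r)) (x : ℕ) :
    p (sqmul sq mul e x) := by
  unfold sqmul
  generalize (if x = 0 then [false] else x.bits.reverse) = l
  induction l generalizing e with
  | nil => exact he
  | cons b l ih =>
    apply ih
    dsimp only
    split
    · exact hmul _ (hsq _ he)
    · exact hsq _ he

/-- If the operator is closed on `[s]`, then all indices lie in `[s]`. -/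
theorem IdxG_lt {s n : ℕ} (hsn : s ≤ 2 ^ n) {f : (Fin n → Bool) → (Fin n → Bool) → Fin n → Bool}
    {idx g : ℕ} (hidx : idx < s) (hg : g < s) (hf : ∀ x < s, ∀ y < s, fG n f x y < s) (x : ℕ) :
    IdxG n f idx g x < s := by
  have hclosed : ∀ a b : Fin n → Bool, valS a < s → valS b < s → valS (f a b) < s := by
    intro a b ha hb
    simpa only [fG, bitsS_valS] using hf _ ha _ hb
  refine sqmul_induction (fun r => valS r < s) ?_ (fun r hr => hclosed r r hr hr)
    (fun r hr => hclosed _ r ?_ hr) x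
  · rwa [valS_bitsS (hidx.trans_le hsn)]
  · rwa [valS_bitsS (hg.trans_le hsn)]

theorem valS_claw0 {s n : ℕ} {f : (Fin n → Bool) → (Fin n → Bool) → Fin n → Bool}
    {idx g : ℕ} {u : Fin n → Bool} :
    valS (claw0 s n f idx g u) = if valS u < s then IdxG n f idx g (valS u) else valS u := by
  unfold claw0
  split
  · exact valS_bitsS (valS_lt _)
  · rfl

theorem valS_claw1 {s n : ℕ} {f : (Fin n → Bool) → (Fin n → Bool) → Fin n → Bool}
    {idx g t : ℕ} {u : Fin n → Bool} :
    valS (claw1 s n f idx g t u) =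
      if valS u < s then fG n f t (IdxG n f idx g (valS u)) else valS u := by
  unfold claw1
  split <;> rfl

/-- A map that agrees with `F` below `s`, where it stays below `s`, and with the identity from `s`
on can only collide below `s`. -/
theorem collision_below {s a b : ℕ} {F : ℕ → ℕ} (hF : ∀ x < s, F x < s) (hab : a ≠ b)
    (h : (if a < s then F a else a) = if b < s then F b else b) :
    a < s ∧ b < s ∧ F a = F b := by
  have ha := hF a
  have hb := hF b
  split at h <;> split at h <;> omega

theorem dlog_to_generalclaw (s : ℕ) (hs : 2 ≤ s) (n : ℕ) (hn : n = Nat.clog 2 s)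
    (f : (Fin n → Bool) → (Fin n → Bool) → Fin n → Bool)
    (idx g t : ℕ) (hidx : idx < s) (hg : g < s) (ht : t < s)
    (h :
      (∃ u v : Fin n → Bool, valS u < s ∧ valS v < s ∧
        claw0 s n f idx g u = claw1 s n f idx g t v) ∨
      (∃ u v : Fin n → Bool, u ≠ v ∧ claw0 s n f idx g u = claw0 s n f idx g v) ∨
      (∃ u v : Fin n → Bool, u ≠ v ∧ claw1 s n f idx g t u = claw1 s n f idx g t v) ∨
      (∃ u : Fin n → Bool, valS u < s ∧ s ≤ valS (claw0 s n f idx g u)) ∨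
      (∃ u : Fin n → Bool, valS u < s ∧ s ≤ valS (claw1 s n f idx g t u))) :
    DLogSol s n f idx g t := by
  have hsn : s ≤ 2 ^ n := hn ▸ Nat.le_pow_clog one_lt_two s
  by_cases hf : ∃ x < s, ∃ y < s, s ≤ fG n f x y
  · exact Or.inr (Or.inl hf)
  push Not at hf
  have hI : ∀ x, IdxG n f idx g x < s := IdxG_lt hsn hidx hg hf
  have hfI : ∀ x, fG n f t (IdxG n f idx g x) < s := fun x => hf t ht _ (hI x)
  rcases h with ⟨u, v, hu, hv, h⟩ | ⟨u, v, huv, h⟩ | ⟨u, v, huv, h⟩ | ⟨u, hu, h⟩ | ⟨u, hu, h⟩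
  · have h := congrArg valS h
    rw [valS_claw0, valS_claw1, if_pos hu, if_pos hv] at h
    by_cases hxy : IdxG n f idx g ((valS u + s - valS v) % s) = t
    · exact Or.inl ⟨_, Nat.mod_lt _ (by omega), hxy⟩
    · exact Or.inr (Or.inr (Or.inr (Or.inr ⟨_, hu, _, hv, h, hxy⟩)))
  · have h := congrArg valS h
    rw [valS_claw0, valS_claw0] at h
    have hne := (valS_injective n).ne huv
    obtain ⟨hu, hv, h⟩ := collision_below (fun x _ => hI x) hne h
    exact Or.inr (Or.inr (Or.inl ⟨_, hu, _, hv, hne, h⟩))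
  · have h := congrArg valS h
    rw [valS_claw1, valS_claw1] at h
    have hne := (valS_injective n).ne huv
    obtain ⟨hu, hv, h⟩ := collision_below
      (F := fun x => fG n f t (IdxG n f idx g x)) (fun x _ => hfI x) hne h
    exact Or.inr (Or.inr (Or.inr (Or.inl ⟨_, hu, _, hv, hne, h⟩)))
  · rw [valS_claw0, if_pos hu] at h
    exact absurd (hI _) h.not_gt
  · rw [valS_claw1, if_pos hu] at h
    exact absurd (hfI _) h.not_gt
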